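/- The bilinear form q on M is symmetric: q(a, b) = q(b, a) for all a, b ∈ M. -/

import Mathlib

open scoped TensorProduct DirectSum

noncomputable section

/-- The pure tensor `a₀ ⊗ a₁ ⊗ ⋯ ⊗ a_{m-1}` in the `m`-th tensor power. -/
def tp (A : Type) [AddCommGroup A] [Module ℂ A] (m : ℕ) (a : ℕ → A) : ⨂[ℂ]^m A :=
  PiTensorProduct.tprod ℂ (fun i : Fin m => a i.1)

/-- The space `M = ⊕_{k=1}^{p} A₁^{⊗k}`; the component of index `k : Fin p` is the
tensor power of degree `k + 1`. -/
abbrev Mspace (p : ℕ) (A : Type) [AddCommGroup A] [Module ℂ A] : Type :=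
  ⨁ k : Fin p, ⨂[ℂ]^(k.1 + 1) A

/-- Inclusion of the degree-`(k+1)` homogeneous component into `M`. -/
def incl (p : ℕ) (A : Type) [AddCommGroup A] [Module ℂ A] (k : Fin p) :
    (⨂[ℂ]^(k.1 + 1) A) →ₗ[ℂ] Mspace p A :=
  DirectSum.lof ℂ (Fin p) (fun k : Fin p => ⨂[ℂ]^(k.1 + 1) A) k

/-- The one-step substitution `id^{⊗r} ⊗ Γ ⊗ id^{⊗(n-2-r)}` followed by `Γ`, evaluated on
a family of `2n−3` arguments; used to state the general associativity condition. -/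
def gammaIns (n : ℕ) (A : Type) [AddCommGroup A] [Module ℂ A]
    (Γ : MultilinearMap ℂ (fun _ : Fin (n - 1) => A) A) (r : ℕ) (a : ℕ → A) : A :=
  Γ (fun i : Fin (n - 1) =>
    if i.1 < r then a i.1
    else if i.1 = r then Γ (fun j : Fin (n - 1) => a (r + j.1))
    else a (i.1 + (n - 2)))

/-- `mul` is the bilinear multiplication of `M = ⊕_{k=1}^{p} A₁^{⊗k}` determined on
homogeneous pure tensors `a = a₁⊗⋯⊗a_k`, `b = b₁⊗⋯⊗b_l` by: `a·b = a ⊗ b` if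
`k + l ≤ p`, and `a·b = Γ(a₁,…,a_k,b₁,…,b_{p+1−k}) ⊗ b_{p+2−k} ⊗ ⋯ ⊗ b_l` if
`k + l > p`. -/
def MulSpec (n p : ℕ) (A : Type) [AddCommGroup A] [Module ℂ A]
    (Γ : MultilinearMap ℂ (fun _ : Fin (n - 1) => A) A)
    (mul : Mspace p A →ₗ[ℂ] Mspace p A →ₗ[ℂ] Mspace p A) : Prop :=
  ∀ (k l : Fin p) (a b : ℕ → A),
    mul (incl p A k (tp A (k.1 + 1) a)) (incl p A l (tp A (l.1 + 1) b)) =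
      if h : (k.1 + 1) + (l.1 + 1) ≤ p then
        incl p A ⟨k.1 + l.1 + 1, by omega⟩
          (tp A (k.1 + l.1 + 1 + 1)
            (fun i => if i < k.1 + 1 then a i else b (i - (k.1 + 1))))
      else
        incl p A ⟨k.1 + l.1 + 1 - p, by have := k.isLt; have := l.isLt; omega⟩
          (tp A (k.1 + l.1 + 1 - p + 1)
            (fun i =>
              if i = 0 then
                Γ (fun j : Fin (n - 1) =>
                  if j.1 < k.1 + 1 then a j.1 else b (j.1 - (k.1 + 1)))
              else b (p - (k.1 + 1) + i)))

/-- The subspace `I_k ⊆ A₁^{⊗k}`: `I₁ = {0}`, and for `2 ≤ k ≤ p`,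
`I_k = {a : a·b = 0 for all b ∈ A₁^{⊗(p+1−k)}}`.  (The component of index `k : Fin p`
has degree `k + 1`.) -/
def Ik (p : ℕ) (A : Type) [AddCommGroup A] [Module ℂ A]
    (mul : Mspace p A →ₗ[ℂ] Mspace p A →ₗ[ℂ] Mspace p A) (k : Fin p) :
    Submodule ℂ (⨂[ℂ]^(k.1 + 1) A) :=
  if k.1 = 0 then ⊥
  else
    ⨅ y : ⨂[ℂ]^(p - (k.1 + 1) + 1) A,
      LinearMap.ker
        ((mul.flip (incl p A ⟨p - (k.1 + 1), by have := k.isLt; omega⟩ y)).comp (incl p A k))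

/-- The subspace `I = ⊕_{k=1}^{p} I_k ⊆ M`. -/
def Isub (p : ℕ) (A : Type) [AddCommGroup A] [Module ℂ A]
    (mul : Mspace p A →ₗ[ℂ] Mspace p A →ₗ[ℂ] Mspace p A) : Submodule ℂ (Mspace p A) :=
  ⨆ k : Fin p, (Ik p A mul k).map (incl p A k)

/-- `qM` is the bilinear form on `M` determined on homogeneous pure tensors
`a ∈ A₁^{⊗k}`, `b ∈ A₁^{⊗l}` by: `q(a,b) = 0` if `k + l ≢ 2 mod p`;
`q(a,b) = q₁(a₁, Γ(a₂,…,a_k,b₁,…,b_l))` if `k + l = n`; and `q(a,b) = q₁(a₁,b₁)` if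
`k = l = 1`. -/
def QSpec (n p : ℕ) (A : Type) [AddCommGroup A] [Module ℂ A]
    (Γ : MultilinearMap ℂ (fun _ : Fin (n - 1) => A) A)
    (q₁ : A →ₗ[ℂ] A →ₗ[ℂ] ℂ)
    (qM : Mspace p A →ₗ[ℂ] Mspace p A →ₗ[ℂ] ℂ) : Prop :=
  ∀ (k l : Fin p) (a b : ℕ → A),
    qM (incl p A k (tp A (k.1 + 1) a)) (incl p A l (tp A (l.1 + 1) b)) =
      if ((k.1 + 1) + (l.1 + 1)) % p = 2 % p then
        (if (k.1 + 1) + (l.1 + 1) = n then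
          q₁ (a 0) (Γ (fun j : Fin (n - 1) =>
            if j.1 + 1 < k.1 + 1 then a (j.1 + 1) else b (j.1 + 1 - (k.1 + 1))))
        else q₁ (a 0) (b 0))
      else 0

/-- Cyclic rotation of `n` arguments leaves `q₁(w₀, Γ(w₁,…,w_{n-1}))` unchanged. -/
theorem cyc_rot (n : ℕ) (hn : 3 ≤ n)
    (A : Type) [AddCommGroup A] [Module ℂ A]
    (Γ : MultilinearMap ℂ (fun _ : Fin (n - 1) => A) A)
    (q₁ : A →ₗ[ℂ] A →ₗ[ℂ] ℂ)
    (hq₁symm : ∀ x y : A, q₁ x y = q₁ y x)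
    (hinv : ∀ a : ℕ → A,
      q₁ (Γ (fun i : Fin (n - 1) => a i.1)) (a (n - 1)) =
        q₁ (a 0) (Γ (fun i : Fin (n - 1) => a (i.1 + 1))))
    (w : ℕ → A) (t : ℕ) :
    q₁ (w (t % n)) (Γ (fun j : Fin (n - 1) => w ((t + (j.1 + 1)) % n))) =
      q₁ (w 0) (Γ (fun j : Fin (n - 1) => w ((j.1 + 1) % n))) := by
  induction t with
  | zero => simp
  | succ t ih =>
    rw [← ih]
    have h := hinv (fun i => w ((t + 1 + i) % n))
    simp only [Nat.add_zero] at h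
    rw [← h, hq₁symm]
    have e : t + 1 + (n - 1) = t + n := by omega
    rw [e, Nat.add_mod_right]
    have e2 : ∀ j : ℕ, t + 1 + j = t + (j + 1) := fun j => by omega
    simp only [e2]

/-- Every pure tensor is of the form `tp`. -/
theorem tprod_eq_tp (A : Type) [AddCommGroup A] [Module ℂ A] (m : ℕ) (v : Fin m → A) :
    PiTensorProduct.tprod ℂ v = tp A m (fun i => if h : i < m then v ⟨i, h⟩ else 0) := by
  unfold tp
  congr 1
  funext i
  simp

/-- Symmetry on pure tensors. -/
theorem qM_symm_pure
    (n p : ℕ) (hn : 3 ≤ n) (hp : p = n - 2)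
    (A : Type) [AddCommGroup A] [Module ℂ A]
    (Γ : MultilinearMap ℂ (fun _ : Fin (n - 1) => A) A)
    (q₁ : A →ₗ[ℂ] A →ₗ[ℂ] ℂ)
    (hq₁symm : ∀ x y : A, q₁ x y = q₁ y x)
    (hinv : ∀ a : ℕ → A,
      q₁ (Γ (fun i : Fin (n - 1) => a i.1)) (a (n - 1)) =
        q₁ (a 0) (Γ (fun i : Fin (n - 1) => a (i.1 + 1))))
    (qM : Mspace p A →ₗ[ℂ] Mspace p A →ₗ[ℂ] ℂ)
    (hqM : QSpec n p A Γ q₁ qM) (k l : Fin p) (a b : ℕ → A) :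
    qM (incl p A k (tp A (k.1 + 1) a)) (incl p A l (tp A (l.1 + 1) b)) =
      qM (incl p A l (tp A (l.1 + 1) b)) (incl p A k (tp A (k.1 + 1) a)) := by
  rw [hqM k l a b, hqM l k b a, Nat.add_comm (l.1 + 1) (k.1 + 1)]
  split_ifs with h1 h2
  · have h := cyc_rot n hn A Γ q₁ hq₁symm hinv
      (fun i => if i < k.1 + 1 then a i else b (i - (k.1 + 1))) (k.1 + 1)
    have hk := k.isLt
    have hl := l.isLt
    have e0 : (k.1 + 1) % n = k.1 + 1 := Nat.mod_eq_of_lt (by omega)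
    simp only [e0] at h
    simp only [lt_irrefl, if_false, Nat.sub_self, Nat.succ_pos, if_true] at h
    have eL : (fun j : Fin (n - 1) => if (j.1 + 1) % n < k.1 + 1 then a ((j.1 + 1) % n)
          else b ((j.1 + 1) % n - (k.1 + 1))) =
        (fun j : Fin (n - 1) => if j.1 + 1 < k.1 + 1 then a (j.1 + 1)
          else b (j.1 + 1 - (k.1 + 1))) := by
      funext j
      have hj := j.isLt
      rw [Nat.mod_eq_of_lt (by omega : j.1 + 1 < n)]
    have eR : (fun j : Fin (n - 1) => if (k.1 + 1 + (j.1 + 1)) % n < k.1 + 1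
          then a ((k.1 + 1 + (j.1 + 1)) % n)
          else b ((k.1 + 1 + (j.1 + 1)) % n - (k.1 + 1))) =
        (fun j : Fin (n - 1) => if j.1 + 1 < l.1 + 1 then b (j.1 + 1)
          else a (j.1 + 1 - (l.1 + 1))) := by
      funext j
      have hj := j.isLt
      by_cases hc : j.1 + 1 < l.1 + 1
      · rw [Nat.mod_eq_of_lt (by omega : k.1 + 1 + (j.1 + 1) < n), if_neg (by omega), if_pos hc]
        congr 1
        omega
      · have e : (k.1 + 1 + (j.1 + 1)) % n = j.1 + 1 - (l.1 + 1) := by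
          rw [Nat.mod_eq_sub_mod (by omega), Nat.mod_eq_of_lt (by omega)]
          omega
        rw [e, if_pos (by omega), if_neg hc]
    rw [eL, eR] at h
    exact h.symm
  · exact hq₁symm _ _
  · rfl

/-- The bilinear form `q` on `M` is symmetric: `q(a, b) = q(b, a)` for
all `a, b ∈ M`. -/
theorem qM_symmetric
    (n p : ℕ) (hn : 3 ≤ n) (hp : p = n - 2)
    (A : Type) [AddCommGroup A] [Module ℂ A] [FiniteDimensional ℂ A]
    (Γ : MultilinearMap ℂ (fun _ : Fin (n - 1) => A) A)
    (q₁ : A →ₗ[ℂ] A →ₗ[ℂ] ℂ)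
    (hq₁symm : ∀ x y : A, q₁ x y = q₁ y x)
    (hq₁nondeg : ∀ x : A, (∀ y : A, q₁ x y = 0) → x = 0)
    (hinv : ∀ a : ℕ → A,
      q₁ (Γ (fun i : Fin (n - 1) => a i.1)) (a (n - 1)) =
        q₁ (a 0) (Γ (fun i : Fin (n - 1) => a (i.1 + 1))))
    (hassoc : ∀ r s : ℕ, r ≤ n - 2 → s ≤ n - 2 → ∀ a : ℕ → A,
      gammaIns n A Γ r a = gammaIns n A Γ s a)
    (mul : Mspace p A →ₗ[ℂ] Mspace p A →ₗ[ℂ] Mspace p A)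
    (hmul : MulSpec n p A Γ mul)
    (qM : Mspace p A →ₗ[ℂ] Mspace p A →ₗ[ℂ] ℂ)
    (hqM : QSpec n p A Γ q₁ qM)
    :
    ∀ a b : Mspace p A, qM a b = qM b a := by
  have key : qM = qM.flip := by
    refine DirectSum.linearMap_ext ℂ fun k => ?_
    refine PiTensorProduct.ext ?_
    ext1 v
    refine DirectSum.linearMap_ext ℂ fun l => ?_
    refine PiTensorProduct.ext ?_
    ext1 u
    have h := qM_symm_pure n p hn hp A Γ q₁ hq₁symm hinv qM hqM k l
      (fun i => if h : i < k.1 + 1 then v ⟨i, h⟩ else 0)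
      (fun i => if h : i < l.1 + 1 then u ⟨i, h⟩ else 0)
    rw [← tprod_eq_tp, ← tprod_eq_tp] at h
    exact h
  intro a b
  exact LinearMap.congr_fun (LinearMap.congr_fun key a) b
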